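/- Let s(x) = αx² + βx + γ with α ≠ 0, let S = {(x, s(x)) : x ∈ ℝ} ⊆ ℝ², and let (x̄, ȳ) ∈ ℝ² with ȳ ≠ s(x̄). Set p := −(β² + 4αȳ − 4αγ − 2)/(4α²), q := −(2αx̄ + β)/(4α³), and Δ := (p/3)³ + (q/2)². If Δ ≥ 0, then the set of points of S nearest to (x̄, ȳ) (in the Euclidean distance of ℝ²) is the singleton {(z₁, s(z₁))}, where z₁ := −β/(2α) + ∛((2αx̄ + β)/(8α³) − √Δ) + ∛((2αx̄ + β)/(8α³) + √Δ), with ∛ denoting the real cube root. -/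

import Mathlib

/-- The real cube root. -/
noncomputable def cbrt (t : ℝ) : ℝ := Real.sign t * |t| ^ ((1 : ℝ) / 3)

theorem cbrt_pow_three (t : ℝ) : cbrt t ^ 3 = t := by
  have h : (|t| ^ ((1 : ℝ) / 3)) ^ 3 = |t| := by
    rw [← Real.rpow_natCast, ← Real.rpow_mul (abs_nonneg t)]
    norm_num
  rw [cbrt, mul_pow, h]
  rcases lt_trichotomy t 0 with ht | rfl | ht
  · rw [Real.sign_of_neg ht, abs_of_neg ht]; ring
  · simp
  · rw [Real.sign_of_pos ht, abs_of_pos ht]; ring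

/-- The product of the two cube roots in Cardano's formula for `x³ + px + q`. -/
theorem cbrt_mul_cbrt_cardano {p q : ℝ} (h : 0 ≤ (p / 3) ^ 3 + (q / 2) ^ 2) :
    cbrt (-q / 2 - √((p / 3) ^ 3 + (q / 2) ^ 2)) *
      cbrt (-q / 2 + √((p / 3) ^ 3 + (q / 2) ^ 2)) = -p / 3 := by
  have h3 : Odd 3 := by decide
  apply h3.strictMono_pow.injective
  simp only [mul_pow, cbrt_pow_three]
  linear_combination -Real.sq_sqrt h

/-- The squared distance from a point to a parabola, compared at two parameters of which the
second satisfies the Cardano relations for the critical point. -/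
theorem parabola_sq_dist_sub {α β γ xb yb a b : ℝ} (hα : α ≠ 0)
    (hab : 12 * α ^ 2 * (a * b) = β ^ 2 + 4 * α * yb - 4 * α * γ - 2)
    (hsum : 4 * α ^ 3 * (a ^ 3 + b ^ 3) = 2 * α * xb + β) (w : ℝ) :
    ((xb - w) ^ 2 + (yb - (α * w ^ 2 + β * w + γ)) ^ 2) -
      ((xb - (-β / (2 * α) + a + b)) ^ 2 +
        (yb - (α * (-β / (2 * α) + a + b) ^ 2 + β * (-β / (2 * α) + a + b) + γ)) ^ 2) =
      α ^ 2 * (w - (-β / (2 * α) + a + b)) ^ 2 *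
        ((w + β / (2 * α) + a + b) ^ 2 + 2 * (a ^ 2 - a * b + b ^ 2)) := by
  obtain ⟨v, rfl⟩ : ∃ v, w = v - β / (2 * α) := ⟨w + β / (2 * α), by ring⟩
  obtain ⟨k, rfl⟩ : ∃ k, β = 2 * α * k := ⟨β / (2 * α), by field_simp⟩
  have hk : 2 * α * k / (2 * α) = k := by field_simp
  have hk' : -(2 * α * k) / (2 * α) = -k := by field_simp
  rw [hk, hk']
  have hx : xb = 2 * α ^ 2 * (a ^ 3 + b ^ 3) - k := by
    apply mul_left_cancel₀ (mul_ne_zero two_ne_zero hα)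
    linear_combination -hsum
  subst hx
  linear_combination ((v ^ 2 - (a + b) ^ 2) / 2) * hab

/-- projection onto the graph of `s(x) = αx² + βx + γ` in the case
`Δ ≥ 0`. -/
theorem stmt_11 (α β γ xb yb p q Δ z₁ : ℝ) (hα : α ≠ 0)
    (hy : yb ≠ α * xb ^ 2 + β * xb + γ)
    (hp : p = -(β ^ 2 + 4 * α * yb - 4 * α * γ - 2) / (4 * α ^ 2))
    (hq : q = -(2 * α * xb + β) / (4 * α ^ 3))
    (hΔ : Δ = (p / 3) ^ 3 + (q / 2) ^ 2)
    (hz₁ : z₁ = -β / (2 * α) + cbrt ((2 * α * xb + β) / (8 * α ^ 3) - Real.sqrt Δ)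
        + cbrt ((2 * α * xb + β) / (8 * α ^ 3) + Real.sqrt Δ))
    (hcase : 0 ≤ Δ) :
    {z : ℝ × ℝ | (∃ x : ℝ, z = (x, α * x ^ 2 + β * x + γ)) ∧
        ∀ w : ℝ, Real.sqrt ((xb - z.1) ^ 2 + (yb - z.2) ^ 2) ≤
          Real.sqrt ((xb - w) ^ 2 + (yb - (α * w ^ 2 + β * w + γ)) ^ 2)} =
      {(z₁, α * z₁ ^ 2 + β * z₁ + γ)} := by
  have hsq : √Δ = √((p / 3) ^ 3 + (q / 2) ^ 2) := by rw [hΔ]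
  have hq2 : (2 * α * xb + β) / (8 * α ^ 3) = -q / 2 := by rw [hq]; field_simp; ring
  rw [hq2, hsq] at hz₁
  have hmul := cbrt_mul_cbrt_cardano (hΔ ▸ hcase)
  have ha := cbrt_pow_three (-q / 2 - √((p / 3) ^ 3 + (q / 2) ^ 2))
  have hb := cbrt_pow_three (-q / 2 + √((p / 3) ^ 3 + (q / 2) ^ 2))
  generalize cbrt (-q / 2 - √((p / 3) ^ 3 + (q / 2) ^ 2)) = a at *
  generalize cbrt (-q / 2 + √((p / 3) ^ 3 + (q / 2) ^ 2)) = b at *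
  have hab : 12 * α ^ 2 * (a * b) = β ^ 2 + 4 * α * yb - 4 * α * γ - 2 := by
    rw [hmul, hp]; field_simp; ring
  have hsum : 4 * α ^ 3 * (a ^ 3 + b ^ 3) = 2 * α * xb + β := by
    rw [ha, hb, sub_add_add_cancel, hq]; field_simp; ring
  have key := parabola_sq_dist_sub hα hab hsum
  rw [← hz₁] at key
  have hnn : 0 ≤ a ^ 2 - a * b + b ^ 2 := by nlinarith [sq_nonneg (a - b), sq_nonneg (a + b)]
  have hmin : ∀ w : ℝ, (xb - z₁) ^ 2 + (yb - (α * z₁ ^ 2 + β * z₁ + γ)) ^ 2 ≤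
      (xb - w) ^ 2 + (yb - (α * w ^ 2 + β * w + γ)) ^ 2 := fun w => by
    rw [← sub_nonneg, key]; positivity
  ext z
  simp only [Set.mem_ofPred_eq, Set.mem_singleton_iff]
  constructor
  · rintro ⟨⟨x, rfl⟩, h⟩
    suffices x = z₁ by rw [this]
    have hle := (Real.sqrt_le_sqrt_iff (by positivity)).1 (h z₁)
    have hzero := (key x).symm.trans (sub_eq_zero.2 (hle.antisymm (hmin x)))
    rcases mul_eq_zero.1 hzero with h0 | h0
    · exact sub_eq_zero.1 (pow_eq_zero_iff two_ne_zero |>.1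
        ((mul_eq_zero.1 h0).resolve_left (pow_ne_zero 2 hα)))
    · have hv : x + β / (2 * α) + a + b = 0 := by
        apply pow_eq_zero_iff two_ne_zero |>.1
        linarith [sq_nonneg (x + β / (2 * α) + a + b)]
      rw [hv] at h0
      have hs : a + b = 0 := by
        apply pow_eq_zero_iff two_ne_zero |>.1
        linarith [sq_nonneg (a - b), sq_nonneg (a + b)]
      rw [hz₁]
      linear_combination hv - 2 * hs
  · rintro rfl
    exact ⟨⟨z₁, rfl⟩, fun w => Real.sqrt_le_sqrt (hmin w)⟩
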